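/- arXiv:2409.04451 — 2 statements merged into one kernel-verified Lean document; each statement's English description precedes it below -/
import Mathlib

section
/- If N is a friend of 20, then N > 2·10¹². -/
/-- `N` is a friend of `20`: `N > 20` and `σ(N)/N = 21/10`, i.e. `10·σ(N) = 21·N`. -/
def IsFriendOf20 (N : ℕ) : Prop :=
  20 < N ∧ 10 * ArithmeticFunction.sigma 1 N = 21 * N

open ArithmeticFunction in
/-- The abundancy index `σ(n)/n` strictly increases when passing to a proper multiple. -/
theorem sigma_one_mul_lt_sigma_one_mul {d k : ℕ} (hd : 0 < d) (hk : 1 < k) :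
    sigma 1 d * k < sigma 1 (d * k) := by
  rw [sigma_one_apply, sigma_one_apply, Finset.sum_mul]
  have hinj : Set.InjOn (fun x : ℕ => x * k) d.divisors := fun x _ y _ h =>
    Nat.eq_of_mul_eq_mul_right (by lia) h
  rw [← Finset.sum_image (f := fun x : ℕ => x) hinj]
  refine Finset.sum_lt_sum_of_subset (i := 1) ?_ ?_ ?_ one_pos fun _ _ _ => Nat.zero_le _
  · intro x hx
    obtain ⟨y, hy, rfl⟩ := Finset.mem_image.1 hx
    exact Nat.mem_divisors.2
      ⟨Nat.mul_dvd_mul_right (Nat.dvd_of_mem_divisors hy) k, (Nat.mul_pos hd (by lia)).ne'⟩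
  · exact Nat.one_mem_divisors.2 (Nat.mul_pos hd (by lia)).ne'
  · intro h
    obtain ⟨y, -, hy⟩ := Finset.mem_image.1 h
    exact hk.ne' (Nat.eq_one_of_mul_eq_one_left hy)

open ArithmeticFunction in
/-- An odd number with an odd sum of divisors is a perfect square. -/
theorem isSquare_of_odd_of_odd_sigma_one {n : ℕ} (hn : Odd n) (hs : Odd (sigma 1 n)) :
    IsSquare n := by
  by_contra hsq
  have hn0 : n ≠ 0 := hn.pos.ne'
  have hcast : ∀ d ∈ n.divisors, (d : ZMod 2) = 1 := fun d hd =>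
    (ZMod.natCast_eq_one_iff_odd).2 (hn.of_dvd_nat (Nat.dvd_of_mem_divisors hd))
  have hdiv : ∀ d ∈ n.divisors, n / d ∈ n.divisors := fun d hd =>
    Nat.mem_divisors.2 ⟨Nat.div_dvd_of_dvd (Nat.dvd_of_mem_divisors hd), hn0⟩
  have hsum : ∑ d ∈ n.divisors, (d : ZMod 2) = 0 := by
    refine Finset.sum_involution (fun d _ => n / d) (fun d hd => ?_) (fun d hd _ h => ?_)
      hdiv (fun d hd => Nat.div_div_self (Nat.dvd_of_mem_divisors hd) hn0)
    · rw [hcast d hd, hcast _ (hdiv d hd)]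
      rfl
    · refine hsq ⟨d, ?_⟩
      have := Nat.div_mul_cancel (Nat.dvd_of_mem_divisors hd)
      rw [h] at this
      exact this.symm
  rw [← Nat.cast_sum, ← sigma_one_apply, (ZMod.natCast_eq_one_iff_odd).2 hs] at hsum
  exact one_ne_zero hsum

/-- If `m = p ^ c * k` with `p ∤ k` and `σ(m²)/m² = 7/5`, then `σ(p ^ (2 * c)) ∣ 7 * k ^ 2`. -/
theorem geom_sum_dvd_of_sigma_sq {p c k : ℕ} (hp : p.Prime) (hpk : ¬ p ∣ k)
    (h : 5 * ArithmeticFunction.sigma 1 ((p ^ c * k) ^ 2) = 7 * (p ^ c * k) ^ 2) :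
    (∑ i ∈ Finset.range (2 * c + 1), p ^ i) ∣ 7 * k ^ 2 := by
  have hcop : Nat.Coprime (p ^ (2 * c)) (k ^ 2) :=
    Nat.Coprime.pow _ _ ((Nat.Prime.coprime_iff_not_dvd hp).2 hpk)
  have hsq : (p ^ c * k) ^ 2 = p ^ (2 * c) * k ^ 2 := by ring
  rw [hsq, ArithmeticFunction.isMultiplicative_sigma.map_mul_of_coprime hcop,
    ArithmeticFunction.sigma_one_apply_prime_pow hp] at h
  have hgeom : Nat.Coprime (∑ i ∈ Finset.range (2 * c + 1), p ^ i) (p ^ (2 * c)) := by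
    refine Nat.Coprime.pow_right _ (Nat.Coprime.symm ((Nat.Prime.coprime_iff_not_dvd hp).2 ?_))
    rw [Finset.sum_range_succ', pow_zero]
    intro hdvd
    have : p ∣ ∑ i ∈ Finset.range (2 * c), p ^ (i + 1) :=
      Finset.dvd_sum fun i _ => dvd_pow_self p i.succ_ne_zero
    exact hp.one_lt.ne' (Nat.dvd_one.1 ((Nat.dvd_add_right this).1 hdvd))
  refine hgeom.dvd_of_dvd_mul_left (Dvd.intro_left
    (5 * ArithmeticFunction.sigma 1 (k ^ 2)) ?_)
  linarith

theorem Nat.Prime.dvd_of_dvd_seven_mul_sq {q k : ℕ} (hq : q.Prime) (hq7 : ¬ q ∣ 7)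
    (h : q ∣ 7 * k ^ 2) : q ∣ k :=
  hq.dvd_of_dvd_pow ((hq.dvd_mul.1 h).resolve_left hq7)

/-- A friend of `20` is twice an odd square `m ^ 2` of abundancy index `7 / 5`, with `5 ∣ m` and
`3 ∤ m`. -/
theorem IsFriendOf20.exists_eq_two_mul_sq {N : ℕ} (hN : IsFriendOf20 N) :
    ∃ m, N = 2 * m ^ 2 ∧ 5 ∣ m ∧ ¬ 3 ∣ m ∧
      5 * ArithmeticFunction.sigma 1 (m ^ 2) = 7 * m ^ 2 := by
  obtain ⟨hgt, h⟩ := hN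
  obtain ⟨M, rfl⟩ : 2 ∣ N := by lia
  have hM2 : ¬ 2 ∣ M := by
    intro hdvd
    obtain ⟨k, hk⟩ : 20 ∣ 2 * M := by lia
    have hlt := sigma_one_mul_lt_sigma_one_mul (d := 20) (k := k) (by lia) (by lia)
    rw [← hk, show ArithmeticFunction.sigma 1 20 = 42 from rfl] at hlt
    lia
  rw [ArithmeticFunction.isMultiplicative_sigma.map_mul_of_coprime
    ((Nat.Prime.coprime_iff_not_dvd Nat.prime_two).2 hM2),
    show ArithmeticFunction.sigma 1 2 = 3 from rfl] at h
  have hM : 5 * ArithmeticFunction.sigma 1 M = 7 * M := by lia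
  obtain ⟨m, hm⟩ := isSquare_of_odd_of_odd_sigma_one (n := M)
    (Nat.odd_iff.2 (by lia)) (Nat.odd_iff.2 (by lia))
  rw [← sq] at hm
  subst hm
  have h5 : 5 ∣ m ^ 2 := by lia
  refine ⟨m, rfl, Nat.prime_five.dvd_of_dvd_pow h5, fun h3 => ?_, hM⟩
  have h3' : 3 ∣ m ^ 2 := dvd_pow h3 two_ne_zero
  obtain ⟨k, hk⟩ : 15 ∣ m ^ 2 := by lia
  have hk1 : 1 < k := by
    by_contra hle
    obtain rfl | rfl : k = 0 ∨ k = 1 := by lia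
    · lia
    · have : m < 4 := by nlinarith
      interval_cases m <;> lia
  have hlt := sigma_one_mul_lt_sigma_one_mul (d := 15) (k := k) (by lia) hk1
  rw [← hk, show ArithmeticFunction.sigma 1 15 = 24 from rfl] at hlt
  lia

/-- The case `5 ∥ m`: then `31 ∣ m`, and the possible powers of `31` are excluded in turn. -/
theorem sigma_sq_ne_of_five_mul {k : ℕ} (hk : 0 < k) (hle : 5 * k ≤ 10 ^ 6) (h3 : ¬ 3 ∣ 5 * k)
    (h31 : 31 ∣ k) :
    5 * ArithmeticFunction.sigma 1 ((5 * k) ^ 2) ≠ 7 * (5 * k) ^ 2 := by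
  intro h
  obtain ⟨c, l, hl, hcl⟩ :=
    Nat.exists_eq_pow_mul_and_not_dvd (n := 5 * k) (by lia) 31 (by lia)
  rw [hcl] at h h3
  have hdvd := geom_sum_dvd_of_sigma_sq (by norm_num) hl h
  have hl0 : 0 < l := Nat.pos_of_ne_zero (by rintro rfl; simp at hl)
  have hc : c < 5 := by
    by_contra! hge
    have := Nat.pow_le_pow_right (n := 31) (by lia) hge
    nlinarith
  interval_cases c
  · lia
  · have : 3 ∣ l := Nat.prime_three.dvd_of_dvd_seven_mul_sq (by lia)
      (dvd_trans (by decide) hdvd)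
    lia
  · have : 17351 ∣ l := Nat.Prime.dvd_of_dvd_seven_mul_sq (by norm_num) (by lia)
      (dvd_trans (by decide) hdvd)
    have := Nat.le_of_dvd hl0 this
    lia
  · have := Nat.le_of_dvd (by positivity) hdvd
    norm_num [Finset.sum_range_succ] at this
    nlinarith
  · have := Nat.le_of_dvd (by positivity) hdvd
    norm_num [Finset.sum_range_succ] at this
    nlinarith

/-- The case `25 ∥ m`: then `11 * 71 ∣ m`, and the possible powers of `11` are excluded in turn. -/
theorem sigma_sq_ne_of_twenty_five_mul {k : ℕ} (hk : 0 < k) (hle : 25 * k ≤ 10 ^ 6)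
    (h3 : ¬ 3 ∣ 25 * k) (h11 : 11 ∣ k) (h71 : 71 ∣ k) :
    5 * ArithmeticFunction.sigma 1 ((25 * k) ^ 2) ≠ 7 * (25 * k) ^ 2 := by
  intro h
  obtain ⟨j, rfl⟩ : 11 * 71 ∣ k := by lia
  by_cases hj : 11 ∣ j
  · obtain ⟨i, rfl⟩ := hj
    rw [show 25 * (11 * 71 * (11 * i)) = 11 ^ 2 * (25 * 71 * i) by ring] at h
    have : 3221 ∣ 25 * 71 * i := Nat.Prime.dvd_of_dvd_seven_mul_sq (by norm_num) (by lia)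
      (dvd_trans (by decide) (geom_sum_dvd_of_sigma_sq (by norm_num) (by lia) h))
    lia
  · have h' := h
    rw [show 25 * (11 * 71 * j) = 11 ^ 1 * (25 * 71 * j) by ring] at h'
    have : 19 ∣ 25 * 71 * j := Nat.Prime.dvd_of_dvd_seven_mul_sq (by norm_num) (by lia)
      (dvd_trans (by decide) (geom_sum_dvd_of_sigma_sq (by norm_num) (by lia) h'))
    obtain ⟨i, rfl⟩ : 19 ∣ j := by lia
    rw [show 25 * (11 * 71 * (19 * i)) = 19 ^ 1 * (25 * 11 * 71 * i) by ring] at h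
    have : 3 ∣ 25 * 11 * 71 * i := Nat.prime_three.dvd_of_dvd_seven_mul_sq (by lia)
      (dvd_trans (by decide) (geom_sum_dvd_of_sigma_sq (by norm_num) (by lia) h))
    lia

/-- A friend of 20 is larger than `2·10¹²`. -/
theorem friend20_lower_bound (N : ℕ) (hN : IsFriendOf20 N) :
    2 * 10 ^ 12 < N := by
  obtain ⟨m, rfl, h5, h3, h⟩ := hN.exists_eq_two_mul_sq
  by_contra! hle
  have hm : m ≤ 10 ^ 6 := by nlinarith
  obtain ⟨c, k, hk, rfl⟩ :=
    Nat.exists_eq_pow_mul_and_not_dvd (n := m) (by rintro rfl; simp at h3) 5 (by lia)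
  have hdvd := geom_sum_dvd_of_sigma_sq Nat.prime_five hk h
  have hk0 : 0 < k := Nat.pos_of_ne_zero (by rintro rfl; simp at hk)
  have hc : c < 9 := by
    by_contra! hge
    have := Nat.pow_le_pow_right (n := 5) (by lia) hge
    nlinarith
  have hbound := Nat.le_of_dvd (by positivity) hdvd
  interval_cases c
  · lia
  · refine sigma_sq_ne_of_five_mul hk0 (by lia) (by lia) ?_ h
    exact Nat.Prime.dvd_of_dvd_seven_mul_sq (by norm_num) (by lia) (dvd_trans (by decide) hdvd)
  · refine sigma_sq_ne_of_twenty_five_mul hk0 (by lia) (by lia) ?_ ?_ h <;>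
    exact Nat.Prime.dvd_of_dvd_seven_mul_sq (by norm_num) (by lia) (dvd_trans (by decide) hdvd)
  · have : 19531 ∣ k := Nat.Prime.dvd_of_dvd_seven_mul_sq (by norm_num) (by lia)
      (dvd_trans (by decide) hdvd)
    lia
  · have h31 : 31 ∣ k := Nat.Prime.dvd_of_dvd_seven_mul_sq (by norm_num) (by lia)
      (dvd_trans (by decide) hdvd)
    have h829 : 829 ∣ k := Nat.Prime.dvd_of_dvd_seven_mul_sq (by norm_num) (by lia)
      (dvd_trans (by decide) hdvd)
    lia
  all_goals
    norm_num [Finset.sum_range_succ] at hbound hm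
    nlinarith
end

section
/- If N is a friend of 20, then N has at least four distinct prime divisors, i.e. ω(N) ≥ 4. -/
open ArithmeticFunction in
/-- A proper multiple has strictly larger abundancy. -/
theorem mul_sigma_one_lt_sigma_one_mul {n k : ℕ} (hn : n ≠ 0) (hk : 1 < k) :
    k * sigma 1 n < sigma 1 (n * k) := by
  have hk0 : k ≠ 0 := by omega
  have h1 : 1 ∉ n.divisors.image (k * ·) := by
    simp only [Finset.mem_image, not_exists, not_and]
    intro d _ h
    exact hk.ne' (Nat.eq_one_of_mul_eq_one_right h)
  have hsub : insert 1 (n.divisors.image (k * ·)) ⊆ (n * k).divisors := by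
    intro x hx
    simp only [Finset.mem_insert, Finset.mem_image, Nat.mem_divisors] at hx ⊢
    refine ⟨?_, by positivity⟩
    rcases hx with rfl | ⟨d, ⟨hd, _⟩, rfl⟩
    · exact one_dvd _
    · rw [mul_comm n k]
      exact mul_dvd_mul_left k hd
  have h := Finset.sum_le_sum_of_subset (f := fun d : ℕ => d) hsub
  rw [Finset.sum_insert h1, Finset.sum_image (by
    intro a _ b _ hab
    exact Nat.eq_of_mul_eq_mul_left (by omega) hab), ← Finset.mul_sum] at h
  rw [sigma_one_apply, sigma_one_apply]
  omega

open ArithmeticFunction in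
theorem sigma_one_prime_pow_succ {p : ℕ} (hp : p.Prime) (c : ℕ) :
    sigma 1 (p ^ (c + 1)) = sigma 1 (p ^ c) + p ^ (c + 1) := by
  rw [sigma_one_apply_prime_pow hp, sigma_one_apply_prime_pow hp, Finset.sum_range_succ]

open ArithmeticFunction in
theorem mul_sigma_one_prime_pow_add_one {p : ℕ} (hp : p.Prime) (c : ℕ) :
    p * sigma 1 (p ^ c) + 1 = sigma 1 (p ^ c) + p * p ^ c := by
  induction c with
  | zero => simp; ring
  | succ c ih =>
    rw [sigma_one_prime_pow_succ hp, pow_succ]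
    linarith

open ArithmeticFunction in
/-- If `σ(7 ^ c)` is odd then it is not divisible by `5`. -/
theorem sigma_one_seven_pow_mod_five_ne_zero {c : ℕ} (h : sigma 1 (7 ^ c) % 2 = 1) :
    sigma 1 (7 ^ c) % 5 ≠ 0 := by
  have key : (sigma 1 (7 ^ c) % 10 = 1 ∧ 7 ^ c % 10 = 1) ∨
      (sigma 1 (7 ^ c) % 10 = 8 ∧ 7 ^ c % 10 = 7) ∨
      (sigma 1 (7 ^ c) % 10 = 7 ∧ 7 ^ c % 10 = 9) ∨
      (sigma 1 (7 ^ c) % 10 = 0 ∧ 7 ^ c % 10 = 3) := by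
    clear h
    induction c with
    | zero => simp
    | succ c ih =>
      rw [sigma_one_prime_pow_succ (by norm_num), pow_succ]
      omega
  omega

open ArithmeticFunction in
theorem sigma_one_five_pow_mul_sigma_one_seven_pow_ne (b c : ℕ) :
    sigma 1 (5 ^ (b + 1)) * sigma 1 (7 ^ c) ≠ 7 * 5 ^ b * 7 ^ c := by
  intro h
  have hodd : Odd (sigma 1 (5 ^ (b + 1)) * sigma 1 (7 ^ c)) := by
    rw [h]
    exact ((by decide : Odd 7).mul ((by decide : Odd 5).pow)).mul ((by decide : Odd 7).pow)
  obtain ⟨h5, h7⟩ := Nat.odd_mul.mp hodd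
  have h7' := sigma_one_seven_pow_mod_five_ne_zero (Nat.odd_iff.mp h7)
  have h5' := mul_sigma_one_prime_pow_add_one Nat.prime_five (b + 1)
  rcases b with _ | b
  · have := Nat.odd_iff.mp h5
    norm_num at h5' this
    omega
  · have hdvd : 5 ∣ sigma 1 (5 ^ (b + 1 + 1)) * sigma 1 (7 ^ c) := by
      rw [h, pow_succ]
      exact ⟨7 * 5 ^ b * 7 ^ c, by ring⟩
    rcases Nat.prime_five.dvd_mul.mp hdvd with hd | hd <;> omega

open ArithmeticFunction in
theorem sigma_one_five_pow_mul_sigma_one_prime_pow_lt {p : ℕ} (hp : p.Prime) (h11 : 11 ≤ p)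
    (b c : ℕ) : 5 * (sigma 1 (5 ^ b) * sigma 1 (p ^ c)) < 7 * (5 ^ b * p ^ c) := by
  have h5 := mul_sigma_one_prime_pow_add_one Nat.prime_five b
  have hpc := mul_sigma_one_prime_pow_add_one hp c
  have hP : 0 < p ^ c := pow_pos hp.pos c
  have h5P : 0 < 5 ^ b := by positivity
  generalize sigma 1 (5 ^ b) = s at *
  generalize sigma 1 (p ^ c) = t at *
  generalize p ^ c = P at *
  generalize 5 ^ b = Q at *
  have hs : 4 * s ≤ 5 * Q := by omega
  have ht : 10 * t ≤ 11 * P := by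
    obtain ⟨r, rfl⟩ := Nat.exists_eq_add_of_le h11
    by_contra! hlt
    nlinarith [Nat.zero_le (r * P), Nat.mul_le_mul_left r hlt.le]
  have := Nat.mul_le_mul hs ht
  nlinarith [Nat.mul_pos h5P hP]

theorem IsFriendOf20.not_twenty_dvd {N : ℕ} (hN : IsFriendOf20 N) : ¬ 20 ∣ N := by
  obtain ⟨hlt, hs⟩ := hN
  rintro ⟨k, rfl⟩
  have := mul_sigma_one_lt_sigma_one_mul (n := 20) (k := k) (by norm_num) (by omega)
  rw [show ArithmeticFunction.sigma 1 20 = 42 by decide] at this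
  omega

theorem IsFriendOf20.not_thirty_dvd {N : ℕ} (hN : IsFriendOf20 N) : ¬ 30 ∣ N := by
  obtain ⟨hlt, hs⟩ := hN
  rintro ⟨k, rfl⟩
  have h30 : ArithmeticFunction.sigma 1 30 = 72 := by decide
  obtain rfl | hk : k = 1 ∨ 1 < k := by omega
  · rw [mul_one, h30] at hs
    omega
  · have := mul_sigma_one_lt_sigma_one_mul (n := 30) (by norm_num) hk
    rw [h30] at this
    omega

/-- A friend of `20` is `2 * 5 ^ (b + 1) * m` with `m` coprime to `10`. -/
theorem IsFriendOf20.exists_eq_two_mul_five_pow_mul {N : ℕ} (hN : IsFriendOf20 N) :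
    ∃ b m : ℕ, N = 2 * (5 ^ (b + 1) * m) ∧ ¬ 2 ∣ m ∧ ¬ 5 ∣ m ∧ m ≠ 0 := by
  have h20 := hN.not_twenty_dvd
  obtain ⟨hlt, hs⟩ := hN
  obtain ⟨M, rfl⟩ : 2 ∣ N := by omega
  obtain ⟨b, m, hm, rfl⟩ := Nat.exists_eq_pow_mul_and_not_dvd (n := M) (by omega) 5 (by norm_num)
  rcases b with _ | b
  · omega
  · refine ⟨b, m, rfl, ?_, hm, ?_⟩
    · rintro ⟨t, rfl⟩
      exact h20 ⟨5 ^ b * t, by ring⟩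
    · rintro rfl
      simp at hm

theorem exists_eq_prime_pow_of_card_primeFactors_le_one {m : ℕ} (hm : m ≠ 0)
    (h : m.primeFactors.card ≤ 1) : m = 1 ∨ ∃ p c : ℕ, p.Prime ∧ c ≠ 0 ∧ m = p ^ c := by
  rcases Nat.le_one_iff_eq_zero_or_eq_one.mp h with h | h
  · left
    simpa [hm] using h
  · right
    obtain ⟨p, c, hp, hc, rfl⟩ :=
      (isPrimePow_nat_iff m).mp (isPrimePow_iff_card_primeFactors_eq_one.mpr h)
    exact ⟨p, c, hp, hc.ne', rfl⟩

/-- A friend of 20 has at least four distinct prime divisors. -/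
theorem friend20_omega_ge_four (N : ℕ) (hN : IsFriendOf20 N) :
    4 ≤ N.primeFactors.card := by
  by_contra! hcard
  have h30 := hN.not_thirty_dvd
  obtain ⟨b, m, rfl, h2, h5, hm⟩ := hN.exists_eq_two_mul_five_pow_mul
  have c5 : Nat.Coprime (5 ^ (b + 1)) m :=
    ((Nat.Prime.coprime_iff_not_dvd Nat.prime_five).mpr h5).pow_left _
  have c2 : Nat.Coprime 2 (5 ^ (b + 1) * m) :=
    Nat.Coprime.mul_right (Nat.Coprime.pow_right _ (by norm_num))
      ((Nat.Prime.coprime_iff_not_dvd Nat.prime_two).mpr h2)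
  rw [c2.primeFactors_mul, Finset.card_union_of_disjoint c2.disjoint_primeFactors,
    c5.primeFactors_mul, Finset.card_union_of_disjoint c5.disjoint_primeFactors,
    Nat.primeFactors_prime_pow (by omega) Nat.prime_five, Nat.prime_two.primeFactors,
    Finset.card_singleton, Finset.card_singleton] at hcard
  have hs := hN.2
  rw [ArithmeticFunction.isMultiplicative_sigma.map_mul_of_coprime c2,
    ArithmeticFunction.isMultiplicative_sigma.map_mul_of_coprime c5,
    show ArithmeticFunction.sigma 1 2 = 3 by decide] at hs
  have hs' : 5 * (ArithmeticFunction.sigma 1 (5 ^ (b + 1)) * ArithmeticFunction.sigma 1 m) =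
      7 * (5 ^ (b + 1) * m) := by omega
  have h7 (c : ℕ) (hc : m = 7 ^ c) : False := by
    subst hc
    apply sigma_one_five_pow_mul_sigma_one_seven_pow_ne b c
    rw [pow_succ 5 b] at hs' ⊢
    linarith
  rcases exists_eq_prime_pow_of_card_primeFactors_le_one hm (by omega) with
    hm1 | ⟨p, c, hp, hc, rfl⟩
  · exact h7 0 hm1
  · have hpm : p ∣ p ^ c := dvd_pow_self p hc
    by_cases h11 : 11 ≤ p
    · exact (sigma_one_five_pow_mul_sigma_one_prime_pow_lt hp h11 (b + 1) c).ne hs'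
    · have h3 : p ≠ 3 := by
        rintro rfl
        obtain ⟨t, ht⟩ := hpm
        exact h30 ⟨5 ^ b * t, by rw [ht]; ring⟩
      interval_cases p <;>
        first
          | exact h2 hpm
          | exact h5 hpm
          | exact h7 c rfl
          | exact h3 rfl
          | exact absurd hp (by norm_num)
end
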